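/- arXiv:1707.09817 — 2 statements merged into one kernel-verified Lean document; each statement's English description precedes it below -/
import Mathlib

section
/- Every connected graph with maximum degree at most 3 that is not isomorphic to K_4 is near-bipartite: its vertex set can be partitioned into sets A and B such that A is an independent set and B induces a forest. -/
open SimpleGraph Set

/-- A set of vertices is independent in `G`. -/
def Indep {V : Type*} (G : SimpleGraph V) (A : Set V) : Prop :=
  ∀ u ∈ A, ∀ v ∈ A, ¬ G.Adj u v

/-- The subgraph of `G` induced by `B` is `d`-degenerate: every finite nonempty
subset of `B` contains a vertex with at most `d` neighbours inside it. -/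
def DegenerateOn {V : Type*} (G : SimpleGraph V) (B : Set V) (d : ℕ) : Prop :=
  ∀ s : Set V, s ⊆ B → s.Finite → s.Nonempty →
    ∃ v ∈ s, (s ∩ G.neighborSet v).ncard ≤ d

/-- `G` is `d`-degenerate. -/
def Degenerate {V : Type*} (G : SimpleGraph V) (d : ℕ) : Prop :=
  DegenerateOn G Set.univ d

/-- `G` is near-bipartite: its vertex set is partitioned into an independent set `A`
and a set `B` inducing a forest. -/
def NearBipartite {V : Type*} (G : SimpleGraph V) : Prop :=
  ∃ A B : Set V, A ∪ B = Set.univ ∧ Disjoint A B ∧ Indep G A ∧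
    (G.induce B).IsAcyclic

/-- `G` has a `k`-degenerate decomposition: a partition into an independent set `A`
and a set `B` inducing a `(k-2)`-degenerate graph. -/
def KDegenDecomp {V : Type*} (G : SimpleGraph V) (k : ℕ) : Prop :=
  ∃ A B : Set V, A ∪ B = Set.univ ∧ Disjoint A B ∧ Indep G A ∧
    DegenerateOn G B (k - 2)

/-- `S` admits a partition into an independent set and a 1-degenerate set. -/
def GoodSet {V : Type*} (G : SimpleGraph V) (S : Set V) : Prop :=
  ∃ A ⊆ S, Indep G A ∧ DegenerateOn G (S \ A) 1

/-- A partition of `S` minus the "hole" `v`. -/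
def HoleCol {V : Type*} (G : SimpleGraph V) (S : Set V) (v : V) (A : Set V) : Prop :=
  v ∈ S ∧ A ⊆ S ∧ v ∉ A ∧ Indep G A ∧ DegenerateOn G ((S \ A) \ {v}) 1

theorem degOn_mono {V : Type*} {G : SimpleGraph V} {B C : Set V} (h : B ⊆ C)
    (hC : DegenerateOn G C 1) : DegenerateOn G B 1 :=
  fun s hs hf hn => hC s (hs.trans h) hf hn

theorem degOn_insert {V : Type*} [Finite V] {G : SimpleGraph V} {B : Set V} {v : V}
    (hB : DegenerateOn G B 1) (hv : (B ∩ G.neighborSet v).ncard ≤ 1) :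
    DegenerateOn G (insert v B) 1 := by
  intro s hs hf hn
  by_cases hvs : v ∈ s
  · refine ⟨v, hvs, le_trans (Set.ncard_le_ncard ?_ (Set.toFinite _)) hv⟩
    rintro x ⟨hx, hx2⟩
    refine ⟨?_, hx2⟩
    rcases hs hx with h | h
    · subst h
      exact absurd hx2 (by simp)
    · exact h
  · apply hB s _ hf hn
    intro x hx
    rcases hs hx with h | h
    · subst h; exact absurd hx hvs
    · exact h

section
variable {V : Type*} [Finite V] {G : SimpleGraph V} {S : Set V}

theorem stuck (hdeg : ∀ v : V, (G.neighborSet v).ncard ≤ 3) (hS : ¬ GoodSet G S)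
    {v : V} {A : Set V} (h : HoleCol G S v A) :
    (A ∩ G.neighborSet v).ncard = 1 ∧ (((S \ A) \ {v}) ∩ G.neighborSet v).ncard = 2 := by
  obtain ⟨hvS, hAS, hvA, hI, hD⟩ := h
  have h1 : 1 ≤ (A ∩ G.neighborSet v).ncard := by
    rw [Nat.one_le_iff_ne_zero, Ne, Set.ncard_eq_zero (Set.toFinite _)]
    intro h0
    apply hS
    have hno : ∀ y ∈ A, ¬ G.Adj v y := fun y hy hadj => by
      have : y ∈ A ∩ G.neighborSet v := ⟨hy, hadj⟩
      rw [h0] at this; exact this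
    refine ⟨insert v A, Set.insert_subset hvS hAS, ?_, degOn_mono ?_ hD⟩
    · rintro x (rfl | hx) y (rfl | hy)
      · simp
      · exact hno y hy
      · exact fun h => hno x hx h.symm
      · exact hI x hx y hy
    · intro x ⟨hx, hx2⟩
      simp only [Set.mem_insert_iff, not_or] at hx2
      exact ⟨⟨hx, hx2.2⟩, hx2.1⟩
  have h2 : 2 ≤ (((S \ A) \ {v}) ∩ G.neighborSet v).ncard := by
    by_contra hlt
    apply hS
    refine ⟨A, hAS, hI, degOn_mono ?_ (degOn_insert (v := v) hD (by omega))⟩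
    intro x hx
    by_cases hxv : x = v
    · left; exact hxv
    · right; exact ⟨hx, hxv⟩
  have h3 : (A ∩ G.neighborSet v).ncard + (((S \ A) \ {v}) ∩ G.neighborSet v).ncard ≤ 3 := by
    rw [← Set.ncard_union_eq _ (Set.toFinite _) (Set.toFinite _)]
    · refine le_trans (Set.ncard_le_ncard ?_ (Set.toFinite _)) (hdeg v)
      rintro x (hx | hx)
      · exact hx.2
      · exact hx.2
    · rw [Set.disjoint_left]
      rintro x ⟨hx, _⟩ ⟨⟨⟨_, hx2⟩, _⟩, _⟩
      exact hx2 hx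
  omega

/-- Moving the hole to an adjacent vertex. -/
theorem move (hdeg : ∀ v : V, (G.neighborSet v).ncard ≤ 3) (hS : ¬ GoodSet G S)
    {v w : V} {A : Set V} (h : HoleCol G S v A) (hw : w ∈ S) (hvw : G.Adj v w) :
    ∃ A', HoleCol G S w A' ∧ (v ∈ A' ↔ w ∈ A) ∧ ∀ x, x ≠ v → x ≠ w → (x ∈ A' ↔ x ∈ A) := by
  obtain ⟨s1, s2⟩ := stuck hdeg hS h
  obtain ⟨hvS, hAS, hvA, hI, hD⟩ := h
  have hne : v ≠ w := hvw.ne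
  by_cases hwA : w ∈ A
  · obtain ⟨x, hx⟩ := Set.ncard_eq_one.1 s1
    have hone : ∀ y ∈ A, G.Adj v y → y = w := by
      intro y hy hvy
      have e1 : y ∈ A ∩ G.neighborSet v := ⟨hy, hvy⟩
      have e2 : w ∈ A ∩ G.neighborSet v := ⟨hwA, hvw⟩
      rw [hx] at e1 e2
      exact e1.trans e2.symm
    refine ⟨insert v (A \ {w}), ⟨hw, ?_, ?_, ?_, ?_⟩, ?_, ?_⟩
    · exact Set.insert_subset hvS (Set.sdiff_subset.trans hAS)
    · simp [hne.symm]
    · clear hx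
      rintro u (rfl | hu) y (rfl | hy)
      · simp
      · exact fun h => hy.2 (hone y hy.1 h)
      · exact fun h => hu.2 (hone u hu.1 h.symm)
      · exact hI u hu.1 y hy.1
    · apply degOn_mono _ hD
      rintro x ⟨⟨hx, hx2⟩, hx3⟩
      simp only [Set.mem_insert_iff, not_or, Set.mem_sdiff, Set.mem_singleton_iff] at hx2 hx3
      refine ⟨⟨hx, fun h => hx2.2 ⟨h, hx3⟩⟩, hx2.1⟩
    · simp [hwA]
    · intro x hxv hxw
      simp [hxv, hxw]
  · refine ⟨A, ⟨hw, hAS, hwA, hI, ?_⟩, ?_, fun _ _ _ => Iff.rfl⟩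
    · have : DegenerateOn G (insert v (((S \ A) \ {v}) \ {w})) 1 := by
        apply degOn_insert (degOn_mono Set.sdiff_subset hD)
        have e : (((S \ A) \ {v}) \ {w}) ∩ G.neighborSet v
            = ((((S \ A) \ {v})) ∩ G.neighborSet v) \ {w} := by
          ext x; simp only [Set.mem_inter_iff, Set.mem_sdiff]; tauto
        rw [e, Set.ncard_sdiff_singleton_of_mem, s2]
        exact ⟨⟨⟨hw, hwA⟩, hne.symm⟩, hvw⟩
      apply degOn_mono _ this
      rintro x ⟨⟨hx, hx2⟩, hx3⟩
      by_cases hxv : x = v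
      · left; exact hxv
      · right; exact ⟨⟨⟨hx, hx2⟩, hxv⟩, hx3⟩
    · simp [hwA, hvA]

theorem shift (hdeg : ∀ v : V, (G.neighborSet v).ncard ≤ 3) (hS : ¬ GoodSet G S)
    (p : ℕ → V) {A : Set V} (h : HoleCol G S (p 0) A) (m : ℕ)
    (hp : ∀ a ≤ m, p a ∈ S) (hinj : ∀ a ≤ m, ∀ b ≤ m, p a = p b → a = b)
    (hadj : ∀ a < m, G.Adj (p a) (p (a + 1))) :
    ∃ A', HoleCol G S (p m) A' ∧ (∀ a < m, (p a ∈ A' ↔ p (a + 1) ∈ A)) ∧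
      ∀ x, (∀ a ≤ m, x ≠ p a) → (x ∈ A' ↔ x ∈ A) := by
  induction m with
  | zero => exact ⟨A, h, by simp, fun _ _ => Iff.rfl⟩
  | succ m ih =>
    obtain ⟨A1, h1, h2, h3⟩ := ih (fun a ha => hp a (by omega))
      (fun a ha b hb => hinj a (by omega) b (by omega)) (fun a ha => hadj a (by omega))
    obtain ⟨A2, g1, g2, g3⟩ := move hdeg hS h1 (hp (m+1) le_rfl) (hadj m (by omega))
    refine ⟨A2, g1, ?_, ?_⟩
    · intro a ha
      by_cases ham : a = m
      · subst ham
        rw [g2]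
        apply h3
        intro b hb hbe
        have := hinj _ le_rfl b (by omega) hbe
        omega
      · rw [g3, h2 a (by omega)]
        · intro he; exact ham (hinj a (by omega) m (by omega) he)
        · intro he; have := hinj a (by omega) (m+1) (by omega) he; omega
    · intro x hx
      rw [g3 x (hx m (by omega)) (hx (m+1) le_rfl)]
      exact h3 x (fun a ha => hx a (by omega))

theorem rot (hdeg : ∀ v : V, (G.neighborSet v).ncard ≤ 3) (hS : ¬ GoodSet G S)
    (p : ℕ → V) {A : Set V} (h : HoleCol G S (p 0) A) (m : ℕ) (hm : 1 ≤ m)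
    (hp : ∀ a ≤ m, p a ∈ S) (hinj : ∀ a ≤ m, ∀ b ≤ m, p a = p b → a = b)
    (hadj : ∀ a < m, G.Adj (p a) (p (a + 1))) (hc : G.Adj (p 0) (p m)) :
    ∃ A', HoleCol G S (p 0) A' ∧ (p m ∈ A' ↔ p 1 ∈ A) ∧
      (∀ a, 1 ≤ a → a < m → (p a ∈ A' ↔ p (a + 1) ∈ A)) ∧
      ∀ x, (∀ a ≤ m, x ≠ p a) → (x ∈ A' ↔ x ∈ A) := by
  obtain ⟨A1, h1, h2, h3⟩ := shift hdeg hS p h m hp hinj hadj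
  obtain ⟨A2, g1, g2, g3⟩ := move hdeg hS h1 (hp 0 (by omega)) hc.symm
  refine ⟨A2, g1, ?_, ?_, ?_⟩
  · rw [g2, h2 0 (by omega)]
  · intro a ha ham
    rw [g3, h2 a ham]
    · intro he; have := hinj a (by omega) m (by omega) he; omega
    · intro he; have := hinj a (by omega) 0 (by omega) he; omega
  · intro x hx
    rw [g3 x (hx m le_rfl) (hx 0 (by omega)), h3 x hx]

/-- A cycle `p 0, ..., p j` in `S` with a chord from `p 0` to `p i`. -/
structure Cfg (G : SimpleGraph V) (S : Set V) (p : ℕ → V) (i j : ℕ) : Prop where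
  hi : 1 < i
  hij : i < j
  mem : ∀ a ≤ j, p a ∈ S
  inj : ∀ a ≤ j, ∀ b ≤ j, p a = p b → a = b
  adj : ∀ a < j, G.Adj (p a) (p (a + 1))
  ci : G.Adj (p 0) (p i)
  cj : G.Adj (p 0) (p j)

theorem exactly (hdeg : ∀ v : V, (G.neighborSet v).ncard ≤ 3) (hS : ¬ GoodSet G S)
    {p : ℕ → V} {i j : ℕ} (c : Cfg G S p i j) {A : Set V} (h : HoleCol G S (p 0) A) :
    (p 1 ∈ A ∧ p i ∉ A ∧ p j ∉ A) ∨ (p 1 ∉ A ∧ p i ∈ A ∧ p j ∉ A) ∨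
      (p 1 ∉ A ∧ p i ∉ A ∧ p j ∈ A) := by
  obtain ⟨s1, s2⟩ := stuck hdeg hS h
  have hi := c.hi
  have hij := c.hij
  have c1 : G.Adj (p 0) (p 1) := c.adj 0 (by omega)
  have n1 : p 1 ≠ p i := fun he => by have := c.inj 1 (by omega) i (by omega) he; omega
  have n2 : p 1 ≠ p j := fun he => by have := c.inj 1 (by omega) j (by omega) he; omega
  have n3 : p i ≠ p j := fun he => by have := c.inj i (by omega) j (by omega) he; omega
  obtain ⟨x, hx⟩ := Set.ncard_eq_one.1 s1
  have hone : ∀ y ∈ A, G.Adj (p 0) y → y = x := by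
    intro y hy hvy
    have e1 : y ∈ A ∩ G.neighborSet (p 0) := ⟨hy, hvy⟩
    rw [hx] at e1
    exact e1
  have hsome : p 1 ∈ A ∨ p i ∈ A ∨ p j ∈ A := by
    by_contra hcon
    push Not at hcon
    have : ({p 1, p i, p j} : Set V) ⊆ ((S \ A) \ {p 0}) ∩ G.neighborSet (p 0) := by
      rintro y (rfl | rfl | rfl)
      · exact ⟨⟨⟨c.mem _ (by omega), hcon.1⟩, c1.ne.symm⟩, c1⟩
      · exact ⟨⟨⟨c.mem _ (by omega), hcon.2.1⟩, c.ci.ne.symm⟩, c.ci⟩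
      · exact ⟨⟨⟨c.mem _ (by omega), hcon.2.2⟩, c.cj.ne.symm⟩, c.cj⟩
    have h3 := Set.ncard_le_ncard this (Set.toFinite _)
    rw [s2, Set.ncard_eq_three.2 ⟨_, _, _, n1, n2, n3, rfl⟩] at h3
    omega
  have a1 := fun h => hone _ h c1
  have a2 := fun h => hone _ h c.ci
  have a3 := fun h => hone _ h c.cj
  by_cases b1 : p 1 ∈ A <;> by_cases b2 : p i ∈ A <;> by_cases b3 : p j ∈ A <;> grind

theorem rotBig (hdeg : ∀ v : V, (G.neighborSet v).ncard ≤ 3) (hS : ¬ GoodSet G S)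
    {p : ℕ → V} {i j : ℕ} (c : Cfg G S p i j) {A : Set V} (h : HoleCol G S (p 0) A) :
    ∃ A', HoleCol G S (p 0) A' ∧ (p j ∈ A' ↔ p 1 ∈ A) ∧
      (∀ a, 1 ≤ a → a < j → (p a ∈ A' ↔ p (a + 1) ∈ A)) := by
  have hi := c.hi
  have hij := c.hij
  obtain ⟨A', h1, h2, h3, _⟩ := rot hdeg hS p h j (by omega) c.mem c.inj c.adj c.cj
  exact ⟨A', h1, h2, h3⟩

theorem rotSmall (hdeg : ∀ v : V, (G.neighborSet v).ncard ≤ 3) (hS : ¬ GoodSet G S)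
    {p : ℕ → V} {i j : ℕ} (c : Cfg G S p i j) {A : Set V} (h : HoleCol G S (p 0) A) :
    ∃ A', HoleCol G S (p 0) A' ∧ (p i ∈ A' ↔ p 1 ∈ A) ∧
      (∀ a, 1 ≤ a → a < i → (p a ∈ A' ↔ p (a + 1) ∈ A)) ∧ (p j ∈ A' ↔ p j ∈ A) := by
  have hi := c.hi
  have hij := c.hij
  obtain ⟨A', h1, h2, h3, h4⟩ := rot hdeg hS p h i (by omega) (fun a ha => c.mem a (by omega))
    (fun a ha b hb => c.inj a (by omega) b (by omega)) (fun a ha => c.adj a (by omega)) c.ci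
  refine ⟨A', h1, h2, h3, h4 _ ?_⟩
  intro a ha he
  have := c.inj j le_rfl a (by omega) he
  omega

theorem claim1 (hdeg : ∀ v : V, (G.neighborSet v).ncard ≤ 3) (hS : ¬ GoodSet G S)
    {p : ℕ → V} {i j : ℕ} (c : Cfg G S p i j) {A : Set V} (h : HoleCol G S (p 0) A)
    (h1 : p 1 ∈ A) : i = 2 := by
  have hi := c.hi
  have hij := c.hij
  by_contra hne
  obtain ⟨A1, a1, a2, a3, a4⟩ := rotSmall hdeg hS c h
  obtain ⟨A2, b1, b2, b3, b4⟩ := rotSmall hdeg hS c a1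
  obtain ⟨A3, c1, c2, c3⟩ := rotBig hdeg hS c h
  obtain ⟨A4, d1, d2, d3, d4⟩ := rotSmall hdeg hS c c1
  have e0 := exactly hdeg hS c h
  have e1 := exactly hdeg hS c a1
  have e2 := exactly hdeg hS c b1
  have e3 := exactly hdeg hS c c1
  have e4 := exactly hdeg hS c d1
  have f1 := a3 1 le_rfl (by omega)
  have f2 := a3 2 (by omega) (by omega)
  have f3 := b3 1 le_rfl (by omega)
  have f4 := c3 2 (by omega) (by omega)
  have f5 := d3 1 le_rfl (by omega)
  have g2 : p 2 ∉ A := fun h2 => h.2.2.2.1 _ h1 _ h2 (c.adj 1 (by omega))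
  have g3 : p 3 ∈ A := by
    by_contra g3
    have : p 1 ∉ A2 := fun hh => g3 (f2.1 (f3.1 hh))
    have : p i ∉ A2 := fun hh => g2 (f1.1 (b2.1 hh))
    have hj : p j ∉ A := by
      rcases e0 with e | e | e
      · exact e.2.2
      · exact absurd h1 e.1
      · exact absurd h1 e.1
    have : p j ∉ A2 := fun hh => hj (a4.1 (b4.1 hh))
    rcases e2 with e | e | e
    · exact absurd e.1 ‹_›
    · exact absurd e.2.1 ‹_›
    · exact absurd e.2.2 ‹_›
  have k1 : p 1 ∈ A4 := f5.2 (f4.2 g3)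
  have k2 : p j ∈ A4 := d4.2 (c2.2 h1)
  rcases e4 with e | e | e
  · exact e.2.2 k2
  · exact e.1 k1
  · exact e.1 k1

/-- Reversal of the cycle. -/
def revp (p : ℕ → V) (j : ℕ) : ℕ → V := fun k => if k = 0 then p 0 else p (j + 1 - k)

theorem Cfg.rev {p : ℕ → V} {i j : ℕ} (c : Cfg G S p i j) :
    Cfg G S (revp p j) (j + 1 - i) j := by
  have hi := c.hi
  have hij := c.hij
  refine ⟨by omega, by omega, ?_, ?_, ?_, ?_, ?_⟩
  · intro a ha
    unfold revp
    split_ifs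
    · exact c.mem _ (by omega)
    · exact c.mem _ (by omega)
  · intro a ha b hb he
    unfold revp at he
    split_ifs at he
    · omega
    · have := c.inj _ (by omega) _ (by omega) he; omega
    · have := c.inj _ (by omega) _ (by omega) he; omega
    · have := c.inj _ (by omega) _ (by omega) he; omega
  · intro a ha
    unfold revp
    rw [if_neg (by omega : ¬ a + 1 = 0)]
    split_ifs with h0
    · subst h0; exact c.cj
    · have := c.adj (j + 1 - (a + 1)) (by omega)
      rw [show j + 1 - (a + 1) + 1 = j + 1 - a by omega] at this
      exact this.symm
  · simp only [revp, if_true]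
    rw [if_neg (by omega), show j + 1 - (j + 1 - i) = i by omega]
    exact c.ci
  · simp only [revp, if_true]
    rw [if_neg (by omega), show j + 1 - j = 1 by omega]
    exact c.adj 0 (by omega)

theorem diamond (hdeg : ∀ v : V, (G.neighborSet v).ncard ≤ 3) (hS : ¬ GoodSet G S)
    {p : ℕ → V} {i j : ℕ} (c : Cfg G S p i j) {A : Set V} (h : HoleCol G S (p 0) A) :
    i = 2 ∧ j = 3 := by
  have hi := c.hi
  have hij := c.hij
  have r0 : revp p j 0 = p 0 := rfl
  have r1 : revp p j 1 = p j := rfl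
  have rj : revp p j j = p 1 := by
    unfold revp; rw [if_neg (by omega), show j + 1 - j = 1 by omega]
  have key : ∀ A, HoleCol G S (p 0) A → p 1 ∈ A → i = 2 ∧ j = 3 := by
    intro A h h1
    have hi2 := claim1 hdeg hS c h h1
    obtain ⟨A3, c1, c2, c3⟩ := rotBig hdeg hS c h
    have := claim1 hdeg hS c.rev (A := A3) c1 (by rw [r1]; exact c2.2 h1)
    omega
  rcases exactly hdeg hS c h with ⟨e, _⟩ | ⟨e1, e2, e3⟩ | ⟨_, _, e⟩
  · exact key A h e
  · obtain ⟨A3, c1, c2, c3⟩ := rotBig hdeg hS c h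
    rcases exactly hdeg hS c c1 with ⟨e, _⟩ | ⟨f1, f2, f3⟩ | ⟨_, _, e⟩
    · exact key A3 c1 e
    · exfalso
      rw [c3 i (by omega) hij] at f2
      exact h.2.2.2.1 _ e2 _ f2 (c.adj i hij)
    · exact absurd (c2.1 e) e1
  · obtain ⟨A3, c1, c2, c3⟩ := rotBig hdeg hS c.rev (A := A) h
    rw [rj, r1] at c2
    exact key A3 c1 (c2.2 e)

/-- A path `p 0, ..., p n` inside `S`. -/
structure PathIn (G : SimpleGraph V) (S : Set V) (p : ℕ → V) (n : ℕ) : Prop where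
  mem : ∀ a ≤ n, p a ∈ S
  inj : ∀ a ≤ n, ∀ b ≤ n, p a = p b → a = b
  adj : ∀ a < n, G.Adj (p a) (p (a + 1))

theorem exists_longest (hne : S.Nonempty) :
    ∃ n p, PathIn G S p n ∧ ∀ q, ¬ PathIn G S q (n + 1) := by
  obtain ⟨x, hx⟩ := hne
  by_contra hcon
  push Not at hcon
  have hall : ∀ n, ∃ p, PathIn G S p n := by
    intro n
    induction n with
    | zero => exact ⟨fun _ => x, fun _ _ => hx, by intros; omega, by intros; omega⟩
    | succ n ih => obtain ⟨p, hp⟩ := ih; exact hcon n p hp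
  obtain ⟨p, hp⟩ := hall (Nat.card V)
  have hf : Function.Injective (fun a : Fin (Nat.card V + 1) => p a) := by
    intro a b he
    exact Fin.ext (hp.inj _ (by omega) _ (by omega) he)
  have := Nat.card_le_card_of_injective _ hf
  simp at this

/-- At the start of a longest path, we find a diamond. -/
theorem diamond_at_end (hdeg : ∀ v : V, (G.neighborSet v).ncard ≤ 3) (hS : ¬ GoodSet G S)
    {p : ℕ → V} {n : ℕ} (hp : PathIn G S p n) (hmax : ∀ q, ¬ PathIn G S q (n + 1))
    {A : Set V} (h : HoleCol G S (p 0) A) :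
    3 ≤ n ∧ G.Adj (p 0) (p 2) ∧ G.Adj (p 0) (p 3) := by
  have hnb : ∀ w ∈ S, G.Adj (p 0) w → ∃ k, 1 ≤ k ∧ k ≤ n ∧ w = p k := by
    intro w hw hadj
    by_contra hcon
    push Not at hcon
    have hw0 : ∀ a ≤ n, w ≠ p a := by
      intro a ha
      rcases Nat.eq_zero_or_pos a with rfl | h0
      · exact hadj.ne.symm
      · exact hcon a h0 ha
    apply hmax (fun k => if k = 0 then w else p (k - 1))
    refine ⟨?_, ?_, ?_⟩
    · intro a ha
      try dsimp only
      split_ifs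
      · exact hw
      · exact hp.mem _ (by omega)
    · intro a ha b hb he
      try dsimp only at he
      split_ifs at he
      · omega
      · exact absurd he (hw0 _ (by omega))
      · exact absurd he.symm (hw0 _ (by omega))
      · have := hp.inj _ (by omega) _ (by omega) he; omega
    · intro a ha
      try dsimp only
      rw [if_neg (by omega : ¬ a + 1 = 0)]
      split_ifs with h0
      · subst h0; exact hadj.symm
      · have := hp.adj (a - 1) (by omega)
        rwa [show a - 1 + 1 = a + 1 - 1 by omega] at this
  obtain ⟨s1, s2⟩ := stuck hdeg hS h
  obtain ⟨x, hx⟩ := Set.ncard_eq_one.1 s1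
  obtain ⟨y, z, hyz, hyz2⟩ := Set.ncard_eq_two.1 s2
  have hx' : x ∈ A ∩ G.neighborSet (p 0) := by rw [hx]; rfl
  have hy' : y ∈ ((S \ A) \ {p 0}) ∩ G.neighborSet (p 0) := by rw [hyz2]; simp
  have hz' : z ∈ ((S \ A) \ {p 0}) ∩ G.neighborSet (p 0) := by rw [hyz2]; simp
  have hxy : x ≠ y := by rintro rfl; exact hy'.1.1.2 hx'.1
  have hxz : x ≠ z := by rintro rfl; exact hz'.1.1.2 hx'.1
  obtain ⟨kx, x1, x2, rfl⟩ := hnb x (h.2.1 hx'.1) hx'.2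
  obtain ⟨ky, y1, y2, rfl⟩ := hnb y hy'.1.1.1 hy'.2
  obtain ⟨kz, z1, z2, rfl⟩ := hnb z hz'.1.1.1 hz'.2
  have nxy : kx ≠ ky := by rintro rfl; exact hxy rfl
  have nxz : kx ≠ kz := by rintro rfl; exact hxz rfl
  have nyz : ky ≠ kz := by rintro rfl; exact hyz rfl
  have ax : G.Adj (p 0) (p kx) := hx'.2
  have ay : G.Adj (p 0) (p ky) := hy'.2
  have az : G.Adj (p 0) (p kz) := hz'.2
  have main : ∀ i j, 1 < i → i < j → j ≤ n → G.Adj (p 0) (p i) → G.Adj (p 0) (p j) →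
      3 ≤ n ∧ G.Adj (p 0) (p 2) ∧ G.Adj (p 0) (p 3) := by
    intro i j hi hij hj ai aj
    have c : Cfg G S p i j := ⟨hi, hij, fun a ha => hp.mem a (by omega),
      fun a ha b hb => hp.inj a (by omega) b (by omega), fun a ha => hp.adj a (by omega), ai, aj⟩
    obtain ⟨rfl, rfl⟩ := diamond hdeg hS c h
    exact ⟨hj, ai, aj⟩
  have main2 : ∀ i j, 1 < i → 1 < j → i ≠ j → i ≤ n → j ≤ n → G.Adj (p 0) (p i) →
      G.Adj (p 0) (p j) → 3 ≤ n ∧ G.Adj (p 0) (p 2) ∧ G.Adj (p 0) (p 3) := by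
    intro i j hi hj hne hi2 hj2 ai aj
    rcases lt_or_gt_of_ne hne with hlt | hlt
    · exact main i j hi hlt hj2 ai aj
    · exact main j i hj hlt hi2 aj ai
  by_cases kx1 : kx = 1
  · exact main2 ky kz (by omega) (by omega) nyz y2 z2 ay az
  · by_cases ky1 : ky = 1
    · exact main2 kx kz (by omega) (by omega) nxz x2 z2 ax az
    · exact main2 kx ky (by omega) (by omega) nxy x2 y2 ax ay

theorem good_of_no_K4 (hdeg : ∀ v : V, (G.neighborSet v).ncard ≤ 3)
    (hK : ∀ a b c d : V, G.Adj a b → G.Adj a c → G.Adj a d → G.Adj b c → G.Adj b d →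
      G.Adj c d → False) (n : ℕ) : ∀ S : Set V, S.ncard = n → GoodSet G S := by
  induction n with
  | zero =>
    intro S hS
    rw [Set.ncard_eq_zero (Set.toFinite _)] at hS
    subst hS
    refine ⟨∅, Set.Subset.rfl, by intro u hu; exact absurd hu (by simp), ?_⟩
    intro s hs _ hn
    obtain ⟨x, hx⟩ := hn
    exact absurd (hs hx) (by simp)
  | succ n ih =>
    intro S hSn
    by_contra hS
    have hcol : ∀ v ∈ S, ∃ A, HoleCol G S v A := by
      intro v hv
      obtain ⟨A, h1, h2, h3⟩ := ih (S \ {v}) (by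
        rw [Set.ncard_sdiff_singleton_of_mem hv, hSn]; rfl)
      refine ⟨A, hv, h1.trans Set.sdiff_subset, fun h => (h1 h).2 rfl, h2, degOn_mono ?_ h3⟩
      rintro x ⟨⟨a, b⟩, c⟩
      exact ⟨⟨a, c⟩, b⟩
    have hne : S.Nonempty := by
      rw [← Set.ncard_pos (Set.toFinite _)]; omega
    obtain ⟨m, p, hp, hmax⟩ := exists_longest (G := G) hne
    obtain ⟨A, hA⟩ := hcol (p 0) (hp.mem 0 (by omega))
    obtain ⟨h3, a02, a03⟩ := diamond_at_end hdeg hS hp hmax hA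
    have hq : PathIn G S (fun k => p (if k = 0 then 1 else if k = 1 then 0 else k)) m := by
      refine ⟨?_, ?_, ?_⟩
      · intro a ha
        apply hp.mem
        split_ifs <;> omega
      · intro a ha b hb he
        have := hp.inj _ (by split_ifs <;> omega) _ (by split_ifs <;> omega) he
        split_ifs at this <;> omega
      · intro a ha
        try dsimp only
        by_cases h0 : a = 0
        · subst h0; exact (hp.adj 0 (by omega)).symm
        · by_cases h1 : a = 1
          · subst h1; exact a02
          · rw [if_neg h0, if_neg h1, if_neg (by omega), if_neg (by omega)]
            exact hp.adj a ha
    obtain ⟨A', hA'⟩ := hcol (p 1) (hp.mem 1 (by omega))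
    obtain ⟨_, a12, a13⟩ := diamond_at_end hdeg hS hq hmax hA'
    exact hK (p 0) (p 1) (p 2) (p 3) (hp.adj 0 (by omega)) a02 a03 a12 a13 (hp.adj 2 (by omega))

theorem acyclic_of_degOn {B : Set V} (h : DegenerateOn G B 1) : (G.induce B).IsAcyclic := by
  intro v c hc
  obtain ⟨w, hw, hw2⟩ := h (Subtype.val '' {x | x ∈ c.support}) (by rintro _ ⟨x, _, rfl⟩; exact x.2)
    (Set.toFinite _) ⟨v, v, by simp, rfl⟩
  obtain ⟨u, hu, rfl⟩ := hw
  have h2 := hc.ncard_neighborSet_toSubgraph_eq_two hu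
  have h3 : (Subtype.val '' (c.toSubgraph.neighborSet u)).ncard = 2 := by
    rw [Set.ncard_image_of_injective _ Subtype.val_injective, h2]
  have h4 := Set.ncard_le_ncard (s := Subtype.val '' (c.toSubgraph.neighborSet u))
    (t := (Subtype.val '' {x | x ∈ c.support}) ∩ G.neighborSet u) (by
      rintro _ ⟨x, hx, rfl⟩
      have hx' : c.toSubgraph.Adj u x := hx
      refine ⟨⟨x, ?_, rfl⟩, ?_⟩
      · have := hx'.snd_mem
        simpa using this
      · have := hx'.adj_sub
        simpa using this) (Set.toFinite _)
  omega

end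

theorem no_K4 {V : Type*} [Fintype V] (G : SimpleGraph V)
    (hconn : G.Connected)
    (hdeg : ∀ v : V, (G.neighborSet v).ncard ≤ 3)
    (hK4 : ¬ Nonempty (G ≃g (⊤ : SimpleGraph (Fin 4))))
    (a b c d : V) (ab : G.Adj a b) (ac : G.Adj a c) (ad : G.Adj a d) (bc : G.Adj b c)
    (bd : G.Adj b d) (cd : G.Adj c d) : False := by
  classical
  have hcl : ∀ x y z w : V, G.Adj x y → G.Adj x z → G.Adj x w → y ≠ z → y ≠ w → z ≠ w →
      ∀ t, G.Adj x t → t = y ∨ t = z ∨ t = w := by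
    intro x y z w h1 h2 h3 n1 n2 n3 t ht
    have e : ({y, z, w} : Set V) = G.neighborSet x := by
      apply Set.eq_of_subset_of_ncard_le
      · rintro s (rfl | rfl | rfl) <;> assumption
      · rw [Set.ncard_eq_three.2 ⟨_, _, _, n1, n2, n3, rfl⟩]; exact hdeg x
      · exact Set.toFinite _
    have : t ∈ G.neighborSet x := ht
    rw [← e] at this
    exact this
  have ha := hcl a b c d ab ac ad bc.ne bd.ne cd.ne
  have hb := hcl b a c d ab.symm bc bd ac.ne ad.ne cd.ne
  have hc := hcl c a b d ac.symm bc.symm cd ab.ne ad.ne bd.ne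
  have hd := hcl d a b c ad.symm bd.symm cd.symm ab.ne ac.ne bc.ne
  have hw : ∀ x y : V, G.Walk x y → (x = a ∨ x = b ∨ x = c ∨ x = d) →
      (y = a ∨ y = b ∨ y = c ∨ y = d) := by
    intro x y w
    induction w with
    | nil => exact id
    | cons hadj _ ih =>
      intro hx
      apply ih
      rcases hx with rfl | rfl | rfl | rfl
      · have := ha _ hadj; tauto
      · have := hb _ hadj; tauto
      · have := hc _ hadj; tauto
      · have := hd _ hadj; tauto
  have hall : ∀ y : V, (y = a ∨ y = b ∨ y = c ∨ y = d) := by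
    intro y
    obtain ⟨w⟩ := hconn.preconnected a y
    exact hw a y w (Or.inl rfl)
  have hun : (Finset.univ : Finset V) = {a, b, c, d} := by
    ext y; simpa using hall y
  have hcard : Fintype.card V = 4 := by
    rw [← Finset.card_univ, hun]
    rw [Finset.card_insert_of_notMem, Finset.card_insert_of_notMem, Finset.card_insert_of_notMem,
      Finset.card_singleton]
    · simpa using cd.ne
    · simpa using ⟨bc.ne, bd.ne⟩
    · simpa using ⟨ab.ne, ac.ne, ad.ne⟩
  have htop : G = ⊤ := by
    ext x y
    simp only [SimpleGraph.top_adj]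
    refine ⟨fun h => h.ne, fun h => ?_⟩
    have ba := ab.symm
    have ca := ac.symm
    have da := ad.symm
    have cb := bc.symm
    have db := bd.symm
    have dc := cd.symm
    rcases hall x with rfl | rfl | rfl | rfl <;> rcases hall y with rfl | rfl | rfl | rfl <;>
      first | assumption | exact absurd rfl h
  subst htop
  exact hK4 ⟨SimpleGraph.Iso.completeGraph (Fintype.equivFinOfCardEq hcard)⟩

/-- Every connected graph with maximum degree at most 3 that is not isomorphic to `K_4`
is near-bipartite. -/
theorem stmt0 {V : Type*} [Fintype V] (G : SimpleGraph V)
    (hconn : G.Connected)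
    (hdeg : ∀ v : V, (G.neighborSet v).ncard ≤ 3)
    (hK4 : ¬ Nonempty (G ≃g (⊤ : SimpleGraph (Fin 4)))) :
    NearBipartite G := by
  obtain ⟨A, _, hI, hD⟩ := good_of_no_K4 hdeg (no_K4 G hconn hdeg hK4) _ Set.univ rfl
  exact ⟨A, Set.univ \ A, by simp, Set.disjoint_sdiff_right, hI, acyclic_of_degOn hD⟩
end

section
/- Let k ≥ 3. In a connected k-regular graph G that contains no K_{k+1} subgraph and contains at least one pair of non-adjacent vertices with a common neighbour (a good pair), G has a k-degenerate decomposition. -/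
open SimpleGraph Set

namespace DD

/-- A nonempty set with all inner degrees at least `k-1`. -/
def IsCore {V : Type*} (G : SimpleGraph V) (k : ℕ) (S : Set V) : Prop :=
  S.Nonempty ∧ ∀ v ∈ S, k - 1 ≤ (S ∩ G.neighborSet v).ncard

/-- Independent set whose complement has cores only through a single vertex. -/
def PreSt {V : Type*} (G : SimpleGraph V) (k : ℕ) (A : Set V) : Prop :=
  Indep G A ∧ ∃ v, v ∉ A ∧ ∀ S : Set V, IsCore G k S → S ⊆ Aᶜ → v ∈ S

/-- A `PreSt` of maximum size. -/
def St {V : Type*} (G : SimpleGraph V) (k : ℕ) (A : Set V) : Prop :=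
  PreSt G k A ∧ ∀ A', PreSt G k A' → A'.ncard ≤ A.ncard

/-- Connectedness of a vertex subset, via closed subsets. -/
def Conn {V : Type*} (G : SimpleGraph V) (S : Set V) : Prop :=
  ∀ R ⊆ S, R.Nonempty → (∀ r ∈ R, ∀ s ∈ S, G.Adj r s → s ∈ R) → R = S

/-- Data attached to a past component `D` left through `x`. -/
def Past {V : Type*} (G : SimpleGraph V) (k : ℕ) (A : Set V) (p : V) (H D : Set V) (x : V) :
    Prop :=
  D ⊆ H ∧ x ∈ D ∧ x ∈ A ∧ (∀ z ∈ D, z ≠ x → z ∉ A) ∧ Conn G (D \ {x}) ∧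
  (∀ z ∈ D, z ≠ x → ∃ c ∈ A, c ≠ x ∧ G.Adj z c) ∧
  (∀ y, G.Adj x y → y ∈ H ∨ y = p) ∧ k - 1 ≤ (D ∩ G.neighborSet x).ncard

def Inv {V : Type*} (G : SimpleGraph V) (k : ℕ) (A C : Set V) (p : V) (H : Set V) : Prop :=
  St G k A ∧ IsCore G k C ∧ C ⊆ Aᶜ ∧ p ∈ C ∧ Disjoint H C ∧
  ∀ h ∈ H, ∃ D x, h ∈ D ∧ Past G k A p H D x

section
variable {V : Type*} [Fintype V] {k : ℕ} {G : SimpleGraph V}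

lemma greedy (T : Set V)
    (hT : ∀ S ⊆ T, S.Nonempty → ∃ u ∈ S, (S ∩ G.neighborSet u).ncard ≤ k - 1) (hk : 3 ≤ k) :
    ∃ A ⊆ T, Indep G A ∧ ∀ S, IsCore G k S → S ⊆ T \ A → False := by
  induction hn : T.ncard generalizing T with
  | zero =>
    have : T = ∅ := (Set.ncard_eq_zero (Set.toFinite T)).1 hn
    subst this
    refine ⟨∅, subset_rfl, by simp [Indep], ?_⟩
    rintro S ⟨⟨s, hs⟩, -⟩ h
    exact (h hs).1
  | succ n ih =>
    have hne : T.Nonempty := by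
      rw [← Set.ncard_pos (Set.toFinite T)]; omega
    obtain ⟨u, hu, hdeg⟩ := hT T subset_rfl hne
    obtain ⟨A, hA, hI, hC⟩ := ih (T \ {u}) (fun S hS => hT S (hS.trans Set.diff_subset))
      (by rw [Set.ncard_diff_singleton_of_mem hu]; omega)
    have huA : u ∉ A := fun h => (hA h).2 rfl
    by_cases hadj : ∃ a ∈ A, G.Adj u a
    · obtain ⟨a, ha, hua⟩ := hadj
      refine ⟨A, hA.trans Set.diff_subset, hI, ?_⟩
      intro S hS hST
      by_cases huS : u ∈ S
      · have h1 := hS.2 u huS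
        have h2 : insert a (S ∩ G.neighborSet u) ⊆ T ∩ G.neighborSet u := by
          rintro z (rfl | hz)
          · exact ⟨(hA ha).1, hua⟩
          · exact ⟨(hST hz.1).1, hz.2⟩
        have h3 := Set.ncard_le_ncard h2 (Set.toFinite _)
        rw [Set.ncard_insert_of_notMem (fun h => (hST h.1).2 ha) (Set.toFinite _)] at h3
        omega
      · exact hC S hS fun z hz => ⟨⟨(hST hz).1, fun h => huS (h ▸ hz)⟩, (hST hz).2⟩
    · push Not at hadj
      refine ⟨insert u A, ?_, ?_, ?_⟩
      · rintro z (rfl | hz)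
        · exact hu
        · exact (hA hz).1
      · rintro y (rfl | hy) z (rfl | hz)
        · exact G.irrefl
        · exact hadj z hz
        · exact fun h => hadj y hy h.symm
        · exact hI y hy z hz
      · intro S hS hST
        refine hC S hS fun z hz => ⟨⟨(hST hz).1, fun h => (hST hz).2 (Or.inl h)⟩,
          fun h => (hST hz).2 (Or.inr h)⟩

lemma exists_preSt (hk : 3 ≤ k) (hconn : G.Connected)
    (hreg : ∀ v : V, (G.neighborSet v).ncard = k) : ∃ A, PreSt G k A := by
  obtain ⟨v⟩ := hconn.nonempty
  obtain ⟨A, hA, hI, hC⟩ := greedy (G := G) (k := k) ({v}ᶜ) (by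
    intro S hS hne
    by_contra hcon
    push Not at hcon
    have hcl : ∀ u ∈ S, ∀ w, G.Adj u w → w ∈ S := by
      intro u hu w huw
      have h1 := hcon u hu
      have h2 : S ∩ G.neighborSet u = G.neighborSet u :=
        Set.eq_of_subset_of_ncard_le Set.inter_subset_right (by rw [hreg]; omega) (Set.toFinite _)
      have : w ∈ S ∩ G.neighborSet u := by rw [h2]; exact huw
      exact this.1
    obtain ⟨s, hs⟩ := hne
    obtain ⟨w⟩ := hconn.preconnected s v
    have : ∀ {a b : V} (w : G.Walk a b), a ∈ S → b ∈ S := by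
      intro a b w
      induction w with
      | nil => exact id
      | cons h _ ih => exact fun ha => ih (hcl _ ha _ h)
    exact hS (this w hs) rfl) hk
  refine ⟨A, hI, v, fun h => hA h rfl, ?_⟩
  intro S hS hSA
  by_contra hv
  exact hC S hS fun z hz => ⟨fun h => hv (h ▸ hz), hSA hz⟩

lemma exists_St (h : ∃ A, PreSt G k A) : ∃ A, St G k A := by
  obtain ⟨A, hA, hm⟩ := Set.exists_max_image {A | PreSt G k A} Set.ncard (Set.toFinite _) h
  exact ⟨A, hA, hm⟩

section
lemma St.nbr
    (hno : ∀ A : Set V, Indep G A → ∃ S, S ⊆ Aᶜ ∧ IsCore G k S)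
    {A : Set V} (hA : St G k A) {y : V} (hy : y ∉ A) : ∃ a ∈ A, G.Adj y a := by
  by_contra hcon
  push Not at hcon
  obtain ⟨⟨hI, v, hv, hc⟩, hm⟩ := hA
  have hI' : Indep G (insert y A) := by
    rintro u (rfl | hu) w (rfl | hw)
    · exact G.irrefl
    · exact hcon w hw
    · exact fun h => hcon u hu h.symm
    · exact hI u hu w hw
  have hsub : ∀ S : Set V, S ⊆ (insert y A)ᶜ → S ⊆ Aᶜ := fun S hS z hz h => hS hz (Or.inr h)
  by_cases hvy : v = y
  · obtain ⟨S, hS, hSc⟩ := hno _ hI'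
    exact hS (hc S hSc (hsub S hS)) (Or.inl hvy)
  · have := hm (insert y A) ⟨hI', v, by simp [hvy, hv], fun S hS h => hc S hS (hsub S h)⟩
    rw [Set.ncard_insert_of_notMem hy (Set.toFinite _)] at this
    omega

lemma St.exCore
    (hno : ∀ A : Set V, Indep G A → ∃ S, S ⊆ Aᶜ ∧ IsCore G k S)
    {A : Set V} (hA : St G k A) : ∃ C, IsCore G k C ∧ C ⊆ Aᶜ := by
  obtain ⟨S, h1, h2⟩ := hno A hA.1.1
  exact ⟨S, h2, h1⟩
end

section
lemma coreNbr
    (hreg : ∀ v : V, (G.neighborSet v).ncard = k) (hk : 3 ≤ k)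
    {A C : Set V} (hC : IsCore G k C) (hCA : C ⊆ Aᶜ) {y a : V} (hy : y ∈ C)
    (ha : a ∈ A) (hya : G.Adj y a) : insert a (C ∩ G.neighborSet y) = G.neighborSet y := by
  apply Set.eq_of_subset_of_ncard_le _ _ (Set.toFinite _)
  · rintro z (rfl | hz)
    · exact hya
    · exact hz.2
  · rw [Set.ncard_insert_of_notMem (fun h => hCA h.1 ha) (Set.toFinite _), hreg]
    have := hC.2 y hy
    omega

lemma coreUnique
    (hreg : ∀ v : V, (G.neighborSet v).ncard = k) (hk : 3 ≤ k)
    {A C : Set V} (hC : IsCore G k C) (hCA : C ⊆ Aᶜ) {y a b : V} (hy : y ∈ C)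
    (ha : a ∈ A) (hya : G.Adj y a) (hb : b ∈ A) (hyb : G.Adj y b) : b = a := by
  have h : b ∈ G.neighborSet y := hyb
  rw [← coreNbr hreg hk hC hCA hy ha hya] at h
  rcases h with h | h
  · exact h
  · exact absurd hb (hCA h.1)

lemma coreClosed
    (hno : ∀ A : Set V, Indep G A → ∃ S, S ⊆ Aᶜ ∧ IsCore G k S)
    (hreg : ∀ v : V, (G.neighborSet v).ncard = k) (hk : 3 ≤ k)
    {A C : Set V} (hA : St G k A) (hC : IsCore G k C) (hCA : C ⊆ Aᶜ) {y z : V}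
    (hy : y ∈ C) (hyz : G.Adj y z) (hz : z ∉ A) : z ∈ C := by
  obtain ⟨a, ha, hya⟩ := St.nbr hno hA (hCA hy)
  have h : z ∈ G.neighborSet y := hyz
  rw [← coreNbr hreg hk hC hCA hy ha hya] at h
  rcases h with h | h
  · exact absurd (h ▸ ha) hz
  · exact h.1

lemma coreSub
    (hno : ∀ A : Set V, Indep G A → ∃ S, S ⊆ Aᶜ ∧ IsCore G k S)
    (hreg : ∀ v : V, (G.neighborSet v).ncard = k) (hk : 3 ≤ k)
    {A C C' : Set V} (hA : St G k A) (hC : IsCore G k C) (hCA : C ⊆ Aᶜ)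
    (hC' : IsCore G k C') (hCA' : C' ⊆ Aᶜ) : C ⊆ C' := by
  by_contra hcon
  rw [← Set.diff_nonempty] at hcon
  obtain ⟨v, hv, hc⟩ := hA.1.2
  have hcore : IsCore G k (C \ C') := by
    refine ⟨hcon, fun y hy => ?_⟩
    refine (hC.2 y hy.1).trans (Set.ncard_le_ncard ?_ (Set.toFinite _))
    rintro z ⟨hz, hyz⟩
    exact ⟨⟨hz, fun h => hy.2 (coreClosed hno hreg hk hA hC' hCA' h
      (SimpleGraph.Adj.symm hyz) (hCA hy.1))⟩, hyz⟩
  exact (hc _ hcore (Set.diff_subset.trans hCA)).2 (hc _ hC' hCA')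

lemma coreConn
    (hno : ∀ A : Set V, Indep G A → ∃ S, S ⊆ Aᶜ ∧ IsCore G k S)
    (hreg : ∀ v : V, (G.neighborSet v).ncard = k) (hk : 3 ≤ k)
    {A C : Set V} (hA : St G k A) (hC : IsCore G k C) (hCA : C ⊆ Aᶜ) :
    Conn G C := by
  intro R hR hne hcl
  refine hR.antisymm (coreSub hno hreg hk hA hC hCA ⟨hne, fun y hy => ?_⟩ (hR.trans hCA))
  refine (hC.2 y (hR hy)).trans (Set.ncard_le_ncard ?_ (Set.toFinite _))
  rintro z ⟨hz, hyz⟩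
  exact ⟨hcl y hy z hz hyz, hyz⟩

lemma move
    (hno : ∀ A : Set V, Indep G A → ∃ S, S ⊆ Aᶜ ∧ IsCore G k S)
    (hreg : ∀ v : V, (G.neighborSet v).ncard = k) (hk : 3 ≤ k)
    {A C : Set V} (hA : St G k A) (hC : IsCore G k C) (hCA : C ⊆ Aᶜ) {x a : V}
    (hx : x ∈ C) (ha : a ∈ A) (hxa : G.Adj x a) :
    St G k (insert x (A \ {a})) ∧
      ∃ C', IsCore G k C' ∧ C' ⊆ (insert x (A \ {a}))ᶜ ∧ a ∈ C' := by
  have hI : Indep G (insert x (A \ {a})) := by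
    have key : ∀ w ∈ A \ {a}, ¬ G.Adj x w := fun w hw h =>
      hw.2 (coreUnique hreg hk hC hCA hx ha hxa hw.1 h)
    rintro u (rfl | hu) w (rfl | hw)
    · exact G.irrefl
    · exact key w hw
    · exact fun h => key u hu h.symm
    · exact hA.1.1 u hu.1 w hw.1
  have hxA : x ∉ A := hCA hx
  have hax : a ≠ x := fun h => hxA (h ▸ ha)
  have hthru : ∀ S : Set V, IsCore G k S → S ⊆ (insert x (A \ {a}))ᶜ → a ∈ S := by
    intro S hS hSA
    by_contra haS
    have hSA' : S ⊆ Aᶜ := fun z hz hzA =>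
      hSA hz (Or.inr ⟨hzA, fun h => haS (h ▸ hz)⟩)
    exact hSA (coreSub hno hreg hk hA hC hCA hS hSA' hx) (Or.inl rfl)
  have hcard : (insert x (A \ {a})).ncard = A.ncard := by
    rw [Set.ncard_insert_of_notMem (fun h => hxA h.1) (Set.toFinite _),
      Set.ncard_diff_singleton_add_one ha (Set.toFinite _)]
  refine ⟨⟨⟨hI, a, by simp [hax], hthru⟩, fun A' h => by rw [hcard]; exact hA.2 A' h⟩, ?_⟩
  obtain ⟨S, hS, hSc⟩ := hno _ hI
  exact ⟨S, hSc, hS, hthru S hSc hS⟩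

lemma cliqueLem
    (hno : ∀ A : Set V, Indep G A → ∃ S, S ⊆ Aᶜ ∧ IsCore G k S)
    (hreg : ∀ v : V, (G.neighborSet v).ncard = k) (hk : 3 ≤ k)
    {A C : Set V} (hA : St G k A) (hC : IsCore G k C) (hCA : C ⊆ Aᶜ) {y z a : V}
    (hy : y ∈ C) (hz : z ∈ C) (ha : a ∈ A) (hya : G.Adj y a) (hza : G.Adj z a) (hyz : y ≠ z) :
    G.Adj y z := by
  obtain ⟨hA', C', hC', hCA', haC'⟩ := move hno hreg hk hA hC hCA hy ha hya
  have hzA' : z ∉ insert y (A \ {a}) := by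
    rintro (h | h)
    · exact hyz h.symm
    · exact hCA hz h.1
  have hzC' := coreClosed hno hreg hk hA' hC' hCA' haC' hza.symm hzA'
  obtain ⟨c, hc, hzc⟩ := St.nbr hno hA' hzA'
  rcases hc with rfl | hc
  · exact hzc.symm
  · exact absurd (coreUnique hreg hk hC hCA hz ha hza hc.1 hzc) hc.2

lemma exists_noncut {C : Set V} (hC : Conn G C) {p : V} (hp : p ∈ C) (hne : C ≠ {p}) :
    ∃ x ∈ C, x ≠ p ∧ Conn G (C \ {x}) := by
  obtain ⟨T, ⟨hpT, hTC, hTne, hT⟩, hm⟩ := Set.exists_max_image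
    {T : Set V | p ∈ T ∧ T ⊆ C ∧ T ≠ C ∧ Conn G T} Set.ncard (Set.toFinite _)
    ⟨{p}, rfl, by simpa using hp, hne.symm, by
      intro R hR hRne _
      exact (Set.subset_singleton_iff_eq.1 hR).resolve_left hRne.ne_empty⟩
  have : ∃ t ∈ T, ∃ y ∈ C, G.Adj t y ∧ y ∉ T := by
    by_contra hcon
    push Not at hcon
    exact hTne (hC T hTC ⟨p, hpT⟩ hcon)
  obtain ⟨t, ht, y, hy, hty, hyT⟩ := this
  have hconn : Conn G (insert y T) := by
    intro R hR hRne hcl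
    have h1 : (R ∩ T).Nonempty := by
      obtain ⟨r, hr⟩ := hRne
      rcases hR hr with rfl | h
      · exact ⟨t, hcl r hr t (Or.inr ht) hty.symm, ht⟩
      · exact ⟨r, hr, h⟩
    have h2 : R ∩ T = T := hT _ Set.inter_subset_right h1
      fun r hr s hs h => ⟨hcl r hr.1 s (Or.inr hs) h, hs⟩
    have h3 : T ⊆ R := fun z hz => (h2.symm ▸ hz : z ∈ R ∩ T).1
    refine hR.antisymm ?_
    rintro z (rfl | hz)
    · exact hcl t (h3 ht) z (Or.inl rfl) hty
    · exact h3 hz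
  have heq : insert y T = C := by
    by_contra hcon
    have := hm (insert y T) ⟨Or.inr hpT, Set.insert_subset hy hTC, hcon, hconn⟩
    rw [Set.ncard_insert_of_notMem hyT (Set.toFinite _)] at this
    omega
  refine ⟨y, hy, fun h => hyT (h ▸ hpT), ?_⟩
  have hTy : C \ {y} = T := by
    rw [← heq]
    ext z
    constructor
    · rintro ⟨h | h, h2⟩
      · exact absurd h h2
      · exact h
    · exact fun h => ⟨Or.inr h, fun e => hyT (e ▸ h)⟩
  rw [hTy]
  exact hT

lemma disj1
    (hno : ∀ A : Set V, Indep G A → ∃ S, S ⊆ Aᶜ ∧ IsCore G k S)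
    (hreg : ∀ v : V, (G.neighborSet v).ncard = k) (hk : 3 ≤ k)
    (hfree : G.CliqueFree (k + 1)) {A C C' : Set V} (hA : St G k A)
    (hC : IsCore G k C) (hCA : C ⊆ Aᶜ) {x b : V} (hx : x ∈ C) (hb : b ∈ A) (hxb : G.Adj x b)
    (hcut : Conn G (C \ {x})) (hA' : St G k (insert x (A \ {b}))) (hC' : IsCore G k C')
    (hCA' : C' ⊆ (insert x (A \ {b}))ᶜ) : Disjoint C' C := by
  classical
  rw [Set.disjoint_iff_inter_eq_empty]
  by_contra hcon
  rw [← Ne, ← Set.nonempty_iff_ne_empty] at hcon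
  have hsub : C' ∩ C = C \ {x} := by
    refine hcut _ ?_ hcon ?_
    · exact fun z hz => ⟨hz.2, fun h => hCA' hz.1 (Or.inl h)⟩
    · intro r hr s hs hrs
      refine ⟨coreClosed hno hreg hk hA' hC' hCA' hr.1 hrs ?_, hs.1⟩
      rintro (h | h)
      · exact hs.2 h
      · exact hCA hs.1 h.1
  have hzb : ∀ z ∈ C, G.Adj x z → G.Adj z b := by
    intro z hz hxz
    have hzC' : z ∈ C' := (hsub.symm ▸ (⟨hz, fun h => hxz.ne h.symm⟩ : z ∈ C \ {x}) :
      z ∈ C' ∩ C).1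
    obtain ⟨c, hc, hzc⟩ := St.nbr hno hA (hCA hz)
    by_cases hcb : c = b
    · exact hcb ▸ hzc
    · have := coreUnique hreg hk hC' hCA' hzC' (Or.inl rfl) hxz.symm (Or.inr ⟨hc, hcb⟩) hzc
      exact absurd (this ▸ hc) (hCA hx)
  have hclq : G.IsClique (insert b (insert x (C ∩ G.neighborSet x))) := by
    have hW : ∀ z ∈ insert x (C ∩ G.neighborSet x), z ∈ C ∧ G.Adj z b := by
      rintro z (rfl | hz)
      · exact ⟨hx, hxb⟩
      · exact ⟨hz.1, hzb z hz.1 hz.2⟩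
    rintro u (rfl | hu) w (rfl | hw) huw
    · exact absurd rfl huw
    · exact (hW w hw).2.symm
    · exact (hW u hu).2
    · exact cliqueLem hno hreg hk hA hC hCA (hW u hu).1 (hW w hw).1 hb (hW u hu).2 (hW w hw).2 huw
  have hcard : k + 1 ≤ (insert b (insert x (C ∩ G.neighborSet x))).ncard := by
    rw [Set.ncard_insert_of_notMem _ (Set.toFinite _),
      Set.ncard_insert_of_notMem _ (Set.toFinite _)]
    · have := hC.2 x hx
      omega
    · exact fun h => G.irrefl h.2
    · rintro (h | h)
      · exact hxb.ne h.symm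
      · exact hCA h.1 hb
  obtain ⟨t, ht, htc⟩ := Set.exists_subset_card_eq hcard
  refine hfree (Set.toFinite t).toFinset ⟨?_, ?_⟩
  · rw [Set.Finite.coe_toFinset]
    exact hclq.subset ht
  · rw [← Set.ncard_eq_toFinset_card t (Set.toFinite t)]
    exact htc

lemma disj2
    (hno : ∀ A : Set V, Indep G A → ∃ S, S ⊆ Aᶜ ∧ IsCore G k S)
    (hreg : ∀ v : V, (G.neighborSet v).ncard = k) (hk : 3 ≤ k)
    {A C C' H : Set V} {p : V} (hInv : Inv G k A C p H)
    {x b : V} (hx : x ∈ C) (hxp : x ≠ p) (hb : b ∈ A) (hxb : G.Adj x b)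
    (hA' : St G k (insert x (A \ {b}))) (hC' : IsCore G k C')
    (hCA' : C' ⊆ (insert x (A \ {b}))ᶜ) : Disjoint C' H := by
  obtain ⟨hA, hC, hCA, hp, hHC, hpast⟩ := hInv
  rw [Set.disjoint_left]
  intro h hhC' hhH
  obtain ⟨D, xi, hhD, hDH, hxiD, hxiA, hDA, hconn, hc, hnb, hdeg⟩ := hpast h hhH
  have hxH : x ∉ H := fun h => Set.disjoint_left.1 hHC h hx
  have hxib : xi ≠ b := by
    rintro rfl
    rcases hnb x hxb.symm with h | h
    · exact hxH h
    · exact hxp h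
  have hxiA' : xi ∈ insert x (A \ {b}) := Or.inr ⟨hxiA, hxib⟩
  have hDA' : ∀ z ∈ D, z ≠ xi → z ∉ insert x (A \ {b}) := by
    rintro z hz hne (h | h)
    · exact hxH (h ▸ hDH hz)
    · exact hDA z hz hne h.1
  have hsub : C' ∩ (D \ {xi}) = D \ {xi} := by
    refine hconn _ Set.inter_subset_right ⟨h, hhC', hhD, fun e => hCA' hhC' (e ▸ hxiA')⟩ ?_
    intro r hr s hs hrs
    exact ⟨coreClosed hno hreg hk hA' hC' hCA' hr.1 hrs (hDA' s hs.1 hs.2), hs⟩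
  have hDC' : ∀ z ∈ D, z ≠ xi → z ∈ C' := fun z hz hne =>
    (hsub.symm ▸ (⟨hz, hne⟩ : z ∈ D \ {xi}) : z ∈ C' ∩ (D \ {xi})).1
  have hzb : ∀ z ∈ D, G.Adj xi z → G.Adj z b := by
    intro z hz hxz
    obtain ⟨c, hcA, hcx, hzc⟩ := hc z hz hxz.ne'
    by_cases hcb : c = b
    · exact hcb ▸ hzc
    · exact absurd (coreUnique hreg hk hC' hCA' (hDC' z hz hxz.ne') hxiA' hxz.symm
        (Or.inr ⟨hcA, hcb⟩) hzc) hcx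
  obtain ⟨z, w, hz, hw, hzw⟩ := (Set.one_lt_ncard_iff (Set.toFinite _)).1
    (show 1 < (D ∩ G.neighborSet xi).ncard by omega)
  have hxz : G.Adj xi z := hz.2
  have hxw : G.Adj xi w := hw.2
  obtain ⟨hA2, C2, hC2, hCA2, hxiC2⟩ := move hno hreg hk hA' hC' hCA'
    (hDC' z hz.1 hxz.ne') hxiA' hxz.symm
  have hwC2 : w ∈ C2 := by
    refine coreClosed hno hreg hk hA2 hC2 hCA2 hxiC2 hxw ?_
    rintro (h | h)
    · exact hzw h.symm
    · exact hDA' w hw.1 hxw.ne' h.1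
  have hxA : x ∉ A := hCA hx
  have hbC2 : b ∈ C2 := by
    refine coreClosed hno hreg hk hA2 hC2 hCA2 hwC2 (hzb w hw.1 hxw) ?_
    rintro (h | ⟨h | h, -⟩)
    · exact hDA z hz.1 hxz.ne' (h ▸ hb)
    · exact hxA (h ▸ hb)
    · exact h.2 rfl
  have := coreUnique hreg hk hC2 hCA2 hbC2 (Or.inl rfl) (hzb z hz.1 hxz).symm
    (Or.inr ⟨Or.inl rfl, fun h => hxA (h ▸ hxiA)⟩) hxb.symm
  exact hxH (this ▸ hDH hz.1)

lemma step
    (hno : ∀ A : Set V, Indep G A → ∃ S, S ⊆ Aᶜ ∧ IsCore G k S)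
    (hreg : ∀ v : V, (G.neighborSet v).ncard = k) (hk : 3 ≤ k)
    (hfree : G.CliqueFree (k + 1)) {A C H : Set V} {p : V} (hInv : Inv G k A C p H) :
    ∃ A' C' p', Inv G k A' C' p' (H ∪ C) := by
  have hInv' := hInv
  obtain ⟨hA, hC, hCA, hp, hHC, hpast⟩ := hInv'
  obtain ⟨x, hx, hxp, hcut⟩ := exists_noncut (coreConn hno hreg hk hA hC hCA) hp (by
    rintro rfl
    have h1 := hC.2 p hp
    have h2 : ({p} ∩ G.neighborSet p : Set V) = ∅ := by
      ext z
      simp only [Set.mem_inter_iff, Set.mem_singleton_iff, Set.mem_empty_iff_false, iff_false]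
      rintro ⟨rfl, h⟩
      exact G.irrefl h
    rw [h2, Set.ncard_empty] at h1
    omega)
  obtain ⟨b, hb, hxb⟩ := St.nbr hno hA (hCA hx)
  obtain ⟨hA', C', hC', hCA', hbC'⟩ := move hno hreg hk hA hC hCA hx hb hxb
  have d1 := disj1 hno hreg hk hfree hA hC hCA hx hb hxb hcut hA' hC' hCA'
  have d2 := disj2 hno hreg hk hInv hx hxp hb hxb hA' hC' hCA'
  have hxA : x ∉ A := hCA hx
  have hxH : x ∉ H := fun h => Set.disjoint_left.1 hHC h hx
  refine ⟨_, C', b, hA', hC', hCA', hbC', (d2.union_right d1).symm, ?_⟩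
  have hzb : ∀ z, z ∉ insert x (A \ {b}) → z ∈ H ∪ C → ¬ G.Adj z b := by
    intro z hzA hz hadj
    exact Set.disjoint_left.1 (d2.union_right d1)
      (coreClosed hno hreg hk hA' hC' hCA' hbC' hadj.symm hzA) hz
  rintro h (hh | hh)
  · obtain ⟨D, xi, hhD, hDH, hxiD, hxiA, hDA, hconn, hc, hnb, hdeg⟩ := hpast h hh
    have hxib : xi ≠ b := by
      rintro rfl
      rcases hnb x hxb.symm with h | h
      · exact hxH h
      · exact hxp h
    have hDA' : ∀ z ∈ D, z ≠ xi → z ∉ insert x (A \ {b}) := by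
      rintro z hz hne (h | h)
      · exact hxH (h ▸ hDH hz)
      · exact hDA z hz hne h.1
    refine ⟨D, xi, hhD, hDH.trans Set.subset_union_left, hxiD, Or.inr ⟨hxiA, hxib⟩, hDA', hconn,
      ?_, ?_, hdeg⟩
    · intro z hz hne
      obtain ⟨c, hcA, hcx, hzc⟩ := hc z hz hne
      refine ⟨c, Or.inr ⟨hcA, ?_⟩, hcx, hzc⟩
      rintro rfl
      exact hzb z (hDA' z hz hne) (Or.inl (hDH hz)) hzc
    · intro y hy
      rcases hnb y hy with h | rfl
      · exact Or.inl (Or.inl h)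
      · exact Or.inl (Or.inr hp)
  · have hDA' : ∀ z ∈ C, z ≠ x → z ∉ insert x (A \ {b}) := by
      rintro z hz hne (h | h)
      · exact hne h
      · exact hCA hz h.1
    refine ⟨C, x, hh, Set.subset_union_right, hx, Or.inl rfl, hDA', hcut, ?_, ?_, hC.2 x hx⟩
    · intro z hz hne
      obtain ⟨c, hcA, hzc⟩ := St.nbr hno hA (hCA hz)
      refine ⟨c, Or.inr ⟨hcA, ?_⟩, fun h => hxA (h ▸ hcA), hzc⟩
      rintro rfl
      exact hzb z (hDA' z hz hne) (Or.inr hz) hzc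
    · intro y hy
      by_cases hyA : y ∈ A
      · exact Or.inr (coreUnique hreg hk hC hCA hx hb hxb hyA hy)
      · exact Or.inl (Or.inr (coreClosed hno hreg hk hA hC hCA hx hy hyA))

lemma contra
    (hno : ∀ A : Set V, Indep G A → ∃ S, S ⊆ Aᶜ ∧ IsCore G k S)
    (hreg : ∀ v : V, (G.neighborSet v).ncard = k) (hk : 3 ≤ k)
    (hconn : G.Connected) (hfree : G.CliqueFree (k + 1)) : False := by
  obtain ⟨A, hA⟩ := exists_St (exists_preSt hk hconn hreg)
  obtain ⟨C, hC, hCA⟩ := St.exCore hno hA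
  obtain ⟨p, hp⟩ := hC.1
  obtain ⟨H, ⟨A, C, p, hI⟩, hm⟩ := Set.exists_max_image
    {H : Set V | ∃ A C p, Inv G k A C p H} Set.ncard (Set.toFinite _)
    ⟨∅, A, C, p, hA, hC, hCA, hp, by simp, by simp⟩
  have h1 := hm (H ∪ C) (step hno hreg hk hfree hI)
  obtain ⟨-, hC, -, -, hd, -⟩ := hI
  rw [Set.ncard_union_eq hd (Set.toFinite _) (Set.toFinite _)] at h1
  have := (Set.ncard_pos (Set.toFinite C)).2 hC.1
  omega
end
end
end DD

/-- A connected `k`-regular graph (`k ≥ 3`) with no `K_{k+1}` subgraph that contains a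
good pair (two non-adjacent vertices with a common neighbour) has a `k`-degenerate
decomposition. -/
theorem stmt7 {V : Type*} [Fintype V] (k : ℕ) (hk : 3 ≤ k) (G : SimpleGraph V)
    (hconn : G.Connected)
    (hreg : ∀ v : V, (G.neighborSet v).ncard = k)
    (hfree : G.CliqueFree (k + 1))
    (hgood : ∃ u v w : V, u ≠ v ∧ ¬ G.Adj u v ∧ G.Adj u w ∧ G.Adj v w) :
    KDegenDecomp G k := by
  by_contra hcon
  refine DD.contra (G := G) (k := k) ?_ hreg hk hconn hfree
  intro A hA
  by_contra hS
  push Not at hS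
  refine hcon ⟨A, Aᶜ, Set.union_compl_self A, disjoint_compl_right, hA, ?_⟩
  intro s hs _ hne
  by_contra hd
  push Not at hd
  refine hS s hs ⟨hne, fun v hv => ?_⟩
  have := hd v hv
  omega
end
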